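/- If α, β : ℕ → ℕ both fail to be in FI(ℕ) (i.e., each has infinite collapse or finite defect), then the composite x ↦ β(α(x)) is not in FI(ℕ). Hence T(ℕ) \ FI(ℕ) is a subsemigroup of T(ℕ). -/

import Mathlib

/-- `FI`: maps with infinite defect and finite collapse. -/
def FISet (γ : ℕ → ℕ) : Prop :=
  ((Set.range γ)ᶜ : Set ℕ).Infinite ∧ {x : ℕ | ∃ y, y < x ∧ γ y = γ x}.Finite

/-- T(ℕ) \ FI(ℕ) is a subsemigroup of T(ℕ). -/
theorem compl_FI_closed :
    ∀ α β : ℕ → ℕ, ¬ FISet α → ¬ FISet β → ¬ FISet (β ∘ α) := by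
  intro α β hα hβ h
  obtain ⟨hd, hF⟩ := h
  have hCα : {x : ℕ | ∃ y, y < x ∧ α y = α x}.Finite := by
    refine hF.subset ?_
    rintro x ⟨y, hy, e⟩
    exact ⟨y, hy, congrArg β e⟩
  have hD : ((Set.range α)ᶜ : Set ℕ).Finite := by
    by_contra hn
    exact hα ⟨hn, hCα⟩
  apply hβ
  constructor
  · intro hfin
    apply hd
    refine (hfin.union (hD.image β)).subset ?_
    intro z hz
    by_cases hzβ : z ∈ Set.range β
    · right
      obtain ⟨w, rfl⟩ := hzβ
      refine ⟨w, ?_, rfl⟩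
      rintro ⟨v, rfl⟩
      exact hz ⟨v, rfl⟩
    · exact Or.inl hzβ
  · set F : Set ℕ := {x : ℕ | ∃ y, y < x ∧ (β ∘ α) y = (β ∘ α) x} with hFdef
    have hinjF : ∀ a b, a ∉ F → b ∉ F → β (α a) = β (α b) → a = b := by
      intro a b ha hb e
      rcases lt_trichotomy a b with hl | hl | hl
      · exact absurd ⟨a, hl, e⟩ hb
      · exact hl
      · exact absurd ⟨b, hl, e.symm⟩ ha
    set E : Set ℕ := (Set.range α)ᶜ ∪ α '' F with hE
    have hEfin : E.Finite := hD.union (hF.image α)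
    have hrep : ∀ x, x ∉ E → ∃ a, a ∉ F ∧ α a = x := by
      intro x hx
      have hxr : x ∈ Set.range α := by
        by_contra hn
        exact hx (Or.inl hn)
      obtain ⟨a, rfl⟩ := hxr
      exact ⟨a, fun ha => hx (Or.inr ⟨a, ha, rfl⟩), rfl⟩
    have hinj : ∀ x y, x ∉ E → y ∉ E → β x = β y → x = y := by
      intro x y hx hy e
      obtain ⟨a, ha, rfl⟩ := hrep x hx
      obtain ⟨b, hb, rfl⟩ := hrep y hy
      rw [hinjF a b ha hb e]
    have hG : {x : ℕ | x ∉ E ∧ β x ∈ β '' E}.Finite := by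
      refine Set.Finite.of_finite_image (f := β) ((hEfin.image β).subset ?_) ?_
      · rintro _ ⟨x, hx, rfl⟩
        exact hx.2
      · intro x hx y hy e
        exact hinj x y hx.1 hy.1 e
    refine (hEfin.union hG).subset ?_
    rintro x ⟨y, hy, e⟩
    by_cases hx : x ∈ E
    · exact Or.inl hx
    · right
      refine ⟨hx, y, ?_, e⟩
      by_contra hyE
      exact absurd (hinj y x hyE hx e) hy.ne
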